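/- arXiv:1508.02335 — 2 statements merged into one kernel-verified Lean document; each statement's English description precedes it below -/
import Mathlib

section
/- Let Σ be a countable alphabet. For every N ∈ ℕ there exists a factor map π : Σ_AP^ℤ → {0,1}^ℤ whose image is contained in the set of aperiodic N-markers. -/
open Filter
open scoped Classical

/-- The shift on `Λ^ℤ`. -/
def shift {Λ : Type*} (x : ℤ → Λ) : ℤ → Λ := fun i => x (i + 1)

/-- A point of `Λ^ℤ` is aperiodic if no shift `S^p`, `p ≥ 1`, fixes it. -/
def Aperiodic {Λ : Type*} (x : ℤ → Λ) : Prop :=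
  ∀ p : ℕ, 1 ≤ p → (fun i => x (i + (p : ℤ))) ≠ x

/-- `z ∈ {0,1}^ℤ` is `N`-separated: distinct positions of `1`s are at distance `≥ N`. -/
def IsSeparated (N : ℕ) (z : ℤ → Bool) : Prop :=
  ∀ i j : ℤ, z i = true → z j = true → i ≠ j → (N : ℤ) ≤ |i - j|

/-- `z ∈ {0,1}^ℤ` is `(N+1)`-dense: every interval of `N+1` consecutive integers contains a
position of a `1`. -/
def IsDense' (N : ℕ) (z : ℤ → Bool) : Prop :=
  ∀ i : ℤ, ∃ j ∈ Set.Icc i (i + (N : ℤ)), z j = true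

/-- A Borel map defined on the full shift and commuting with the shift. -/
structure IsFactor {Λ Γ : Type*} [MeasurableSpace Λ] [MeasurableSpace Γ]
    (φ : (ℤ → Λ) → (ℤ → Γ)) : Prop where
  measurable : Measurable φ
  equivariant : ∀ x, φ (shift x) = shift (φ x)

theorem IsFactor.comp {Λ Γ Δ : Type*} [MeasurableSpace Λ] [MeasurableSpace Γ] [MeasurableSpace Δ]
    {ψ : (ℤ → Γ) → (ℤ → Δ)} {φ : (ℤ → Λ) → (ℤ → Γ)} (hψ : IsFactor ψ) (hφ : IsFactor φ) :
    IsFactor (fun x => ψ (φ x)) :=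
  ⟨hψ.measurable.comp hφ.measurable, fun x => by rw [hφ.equivariant, hψ.equivariant]⟩

theorem measurable_of_forall_prop {X : Type*} [MeasurableSpace X] {φ : X → ℤ → Bool}
    (h : ∀ i, Measurable fun x => φ x i = true) : Measurable φ :=
  measurable_pi_iff.2 fun i => measurable_to_bool (measurableSet_setOfPred.2 (h i))

theorem aperiodic_iff {Λ : Type*} {x : ℤ → Λ} :
    Aperiodic x ↔ ∀ p : ℕ, 1 ≤ p → ¬ Function.Periodic x (p : ℤ) := by
  simp only [Aperiodic, Function.Periodic, ne_eq, funext_iff]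

theorem aperiodic_shift {Λ : Type*} {x : ℤ → Λ} : Aperiodic (shift x) ↔ Aperiodic x := by
  have (p : ℕ) : Function.Periodic (shift x) (p : ℤ) ↔ Function.Periodic x (p : ℤ) := by
    constructor
    · intro h i
      have := h (i - 1)
      simp only [shift] at this
      convert this using 2 <;> ring
    · intro h i
      have := h (i + 1)
      simp only [shift]
      convert this using 2; ring
  simp only [aperiodic_iff, this]

theorem measurable_aperiodic : Measurable fun y : ℤ → Bool => Aperiodic y := by
  simp only [aperiodic_iff, Function.Periodic]
  refine .forall fun p => .imp measurable_const (.not (.forall fun i => ?_))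
  exact measurableSet_setOfPred.1
    (measurableSet_eq_fun (measurable_pi_apply (i + (p : ℤ))) (measurable_pi_apply i))

/-- Choosing, for each point, the first member of a sequence of factor maps whose image
satisfies a shift-invariant property. -/
theorem exists_factor_choice {Λ : Type*} [MeasurableSpace Λ] {P : (ℤ → Bool) → Prop}
    (hP : Measurable P) (hPs : ∀ y, P (shift y) ↔ P y)
    {φ : ℕ → (ℤ → Λ) → (ℤ → Bool)} (hφ : ∀ n, IsFactor (φ n)) :
    ∃ ψ : (ℤ → Λ) → (ℤ → Bool), IsFactor ψ ∧
      ∀ x, (∃ n, P (φ n x)) → ∃ n, ψ x = φ n x ∧ P (φ n x) := by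
  let p : ℕ → (ℤ → Λ) → Prop := fun n x => P (φ n x) ∨ ∀ m, ¬ P (φ m x)
  have hp : ∀ x, ∃ n, p n x := by
    intro x
    by_cases h : ∃ n, P (φ n x)
    · exact h.imp fun n hn => Or.inl hn
    · exact ⟨0, Or.inr (not_exists.1 h)⟩
  have hm : ∀ n, Measurable fun x => P (φ n x) := fun n => hP.comp (hφ n).measurable
  have hshift : ∀ n x, p n (shift x) ↔ p n x := by
    intro n x
    simp only [p, (hφ _).equivariant, hPs]
  refine ⟨fun x => φ (Nat.find (hp x)) x, ⟨?_, ?_⟩, ?_⟩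
  · exact Measurable.find (fun n => (hφ n).measurable)
      (fun n => measurableSet_setOfPred.2 ((hm n).or (.forall fun m => (hm m).not))) hp
  · intro x
    have : Nat.find (hp (shift x)) = Nat.find (hp x) :=
      Nat.find_congr' (fun {n} => hshift n x)
    simp only [this, (hφ _).equivariant]
  · intro x hx
    refine ⟨_, rfl, (Nat.find_spec (hp x)).resolve_right ?_⟩
    simpa using hx

section Greedy

/-- Some position witnesses that the coding by `B` of the letters below `n` has no period `p`. -/
def Breaks (x : ℤ → ℕ) (n : ℕ) (B : Finset ℕ) (p : ℕ) : Prop :=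
  ∃ i : ℤ, x i < n ∧ x (i + p) < n ∧ ¬ (x i ∈ B ↔ x (i + p) ∈ B)

/-- Adding the letter `n` to `B` breaks the least period not yet broken. -/
def ShouldAdd (x : ℤ → ℕ) (n : ℕ) (B : Finset ℕ) : Prop :=
  ∃ p : ℕ, 1 ≤ p ∧ ¬ Breaks x n B p ∧ (∀ q, 1 ≤ q → q < p → Breaks x n B q) ∧
    ∃ i : ℤ, (x i = n ∧ x (i + p) < n ∧ x (i + p) ∉ B) ∨ (x (i + p) = n ∧ x i < n ∧ x i ∉ B)

/-- The greedily chosen set of letters below `n`. -/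
noncomputable def greedySet (x : ℤ → ℕ) : ℕ → Finset ℕ
  | 0 => ∅
  | n + 1 => if ShouldAdd x n (greedySet x n) then insert n (greedySet x n) else greedySet x n

/-- The binary coding of `x` by the greedily chosen set of letters. -/
noncomputable def greedyCode (x : ℤ → ℕ) (i : ℤ) : Bool :=
  decide (x i ∈ greedySet x (x i + 1))

theorem exists_int_shift {P : ℤ → Prop} : (∃ i, P (i + 1)) ↔ ∃ i, P i :=
  ⟨fun ⟨i, h⟩ => ⟨i + 1, h⟩, fun ⟨i, h⟩ => ⟨i - 1, by simpa using h⟩⟩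

theorem breaks_shift (x : ℤ → ℕ) (n : ℕ) (B : Finset ℕ) (p : ℕ) :
    Breaks (shift x) n B p ↔ Breaks x n B p := by
  unfold Breaks shift
  rw [← exists_int_shift (P := fun i => x i < n ∧ x (i + p) < n ∧ ¬ (x i ∈ B ↔ x (i + p) ∈ B))]
  simp only [add_right_comm _ (p : ℤ) 1]

theorem shouldAdd_shift (x : ℤ → ℕ) (n : ℕ) (B : Finset ℕ) :
    ShouldAdd (shift x) n B ↔ ShouldAdd x n B := by
  unfold ShouldAdd
  simp only [breaks_shift]
  refine exists_congr fun p => and_congr_right fun _ => and_congr_right fun _ =>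
    and_congr_right fun _ => ?_
  unfold shift
  rw [← exists_int_shift (P := fun i => (x i = n ∧ x (i + p) < n ∧ x (i + p) ∉ B) ∨
    (x (i + p) = n ∧ x i < n ∧ x i ∉ B))]
  simp only [add_right_comm _ (p : ℤ) 1]

theorem greedySet_shift (x : ℤ → ℕ) (n : ℕ) : greedySet (shift x) n = greedySet x n := by
  induction n with
  | zero => rfl
  | succ n ih => simp only [greedySet, ih, shouldAdd_shift]

theorem measurable_letter {q : ℕ → Prop} (i : ℤ) : Measurable fun x : ℤ → ℕ => q (x i) :=
  (measurable_from_nat (f := q)).comp (measurable_pi_apply i)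

theorem measurable_breaks (n : ℕ) (B : Finset ℕ) (p : ℕ) :
    Measurable fun x : ℤ → ℕ => Breaks x n B p :=
  .exists fun _ => (measurable_letter (q := (· < n)) _).and <|
    (measurable_letter (q := (· < n)) _).and <|
      ((measurable_letter (q := (· ∈ B)) _).iff (measurable_letter (q := (· ∈ B)) _)).not

theorem measurable_shouldAdd (n : ℕ) (B : Finset ℕ) :
    Measurable fun x : ℤ → ℕ => ShouldAdd x n B := by
  refine .exists fun p => measurable_const.and <| (measurable_breaks n B p).not.and <|
    .and (.forall fun q => .imp measurable_const (.imp measurable_const (measurable_breaks n B q)))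
      (.exists fun i => .or ?_ ?_)
  all_goals exact (measurable_letter (q := (· = n)) _).and <|
    (measurable_letter (q := (· < n)) _).and (measurable_letter (q := (· ∉ B)) _)

theorem measurable_greedySet_eq (n : ℕ) (B : Finset ℕ) :
    Measurable fun x : ℤ → ℕ => greedySet x n = B := by
  induction n generalizing B with
  | zero =>
    simp only [greedySet]
    exact measurable_const
  | succ n ih =>
    have : (fun x : ℤ → ℕ => greedySet x (n + 1) = B) = fun x => ∃ C, greedySet x n = C ∧
        ((ShouldAdd x n C ∧ insert n C = B) ∨ (¬ ShouldAdd x n C ∧ C = B)) := by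
      funext x
      simp only [greedySet, exists_eq_left', eq_iff_iff]
      split_ifs with h <;> simp [h]
    rw [this]
    exact .exists fun C => (ih C).and <|
      ((measurable_shouldAdd n C).and measurable_const).or
        ((measurable_shouldAdd n C).not.and measurable_const)

theorem isFactor_greedyCode : IsFactor greedyCode := by
  constructor
  · refine measurable_of_forall_prop fun i => ?_
    have : (fun x : ℤ → ℕ => greedyCode x i = true) = fun x => ∃ a : ℕ, ∃ B : Finset ℕ,
        x i = a ∧ greedySet x (a + 1) = B ∧ a ∈ B := by
      funext x
      simp [greedyCode]
    rw [this]
    exact .exists fun a => .exists fun B => (measurable_letter (q := (· = a)) i).and <|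
      (measurable_greedySet_eq _ B).and measurable_const
  · intro x
    funext i
    simp only [greedyCode, greedySet_shift]
    rfl

theorem mem_greedySet_succ_of_ne {x : ℤ → ℕ} {m n : ℕ} (h : m ≠ n) :
    m ∈ greedySet x (n + 1) ↔ m ∈ greedySet x n := by
  simp only [greedySet]
  split_ifs <;> simp [h]

theorem lt_of_mem_greedySet {x : ℤ → ℕ} {m n : ℕ} (h : m ∈ greedySet x n) : m < n := by
  induction n with
  | zero => simp [greedySet] at h
  | succ n ih =>
    by_cases hmn : m = n
    · omega
    · have := ih ((mem_greedySet_succ_of_ne hmn).1 h)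
      omega

theorem mem_greedySet_iff {x : ℤ → ℕ} {m n : ℕ} (h : m < n) :
    m ∈ greedySet x n ↔ m ∈ greedySet x (m + 1) := by
  induction n, h using Nat.le_induction with
  | base => rfl
  | succ n hn ih => rw [mem_greedySet_succ_of_ne (by omega), ih]

theorem mem_greedySet_self {x : ℤ → ℕ} {n : ℕ} :
    n ∈ greedySet x (n + 1) ↔ ShouldAdd x n (greedySet x n) := by
  have : n ∉ greedySet x n := fun h => lt_irrefl _ (lt_of_mem_greedySet h)
  simp only [greedySet]
  split_ifs with h <;> simp [h, this]

theorem breaks_mono {x : ℤ → ℕ} {m n p : ℕ} (hmn : m ≤ n)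
    (h : Breaks x m (greedySet x m) p) : Breaks x n (greedySet x n) p := by
  obtain ⟨i, h1, h2, h3⟩ := h
  refine ⟨i, by omega, by omega, ?_⟩
  rwa [mem_greedySet_iff (by omega), mem_greedySet_iff (n := n) (by omega),
    ← mem_greedySet_iff h1, ← mem_greedySet_iff h2]

/-- Once all smaller periods are broken, a period `p` that is never broken must be respected
by all remaining letters. -/
theorem no_smaller_letter_of_not_breaks {x : ℤ → ℕ} {n p : ℕ} (hp : 1 ≤ p)
    (hlt : ∀ q, 1 ≤ q → q < p → Breaks x n (greedySet x n) q)
    (hnot : ∀ m, ¬ Breaks x m (greedySet x m) p) (i : ℤ) :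
    ¬ (x i = n ∧ x (i + p) < n) ∧ ¬ (x (i + p) = n ∧ x i < n) := by
  have key : ∀ j, (x j < n + 1 → x (j + p) < n + 1 →
      (x j ∈ greedySet x (n + 1) ↔ x (j + p) ∈ greedySet x (n + 1))) := by
    intro j h1 h2
    by_contra h3
    exact hnot (n + 1) ⟨j, h1, h2, h3⟩
  by_cases hadd : ShouldAdd x n (greedySet x n)
  · have hmem := mem_greedySet_self.2 hadd
    obtain ⟨q, hq1, hq2, hq3, j, hj⟩ := hadd
    have hqp : q = p := by
      rcases lt_trichotomy q p with h | h | h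
      · exact absurd (hlt q hq1 h) hq2
      · exact h
      · exact absurd (hq3 p hp h) (hnot n)
    subst hqp
    exfalso
    rcases hj with ⟨h1, h2, h3⟩ | ⟨h1, h2, h3⟩
    · have := key j (by omega) (by omega)
      rw [mem_greedySet_succ_of_ne (m := x (j + q)) (by omega), h1] at this
      exact h3 (this.1 hmem)
    · have := key j (by omega) (by omega)
      rw [mem_greedySet_succ_of_ne (m := x j) (by omega), h1] at this
      exact h3 (this.2 hmem)
  · have hmem : n ∉ greedySet x (n + 1) := fun h => hadd (mem_greedySet_self.1 h)
    constructor
    · rintro ⟨h1, h2⟩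
      refine hadd ⟨p, hp, hnot n, hlt, i, Or.inl ⟨h1, h2, fun h3 => hmem ?_⟩⟩
      have := key i (by omega) (by omega)
      rw [mem_greedySet_succ_of_ne (m := x (i + p)) (by omega), h1] at this
      exact this.2 h3
    · rintro ⟨h1, h2⟩
      refine hadd ⟨p, hp, hnot n, hlt, i, Or.inr ⟨h1, h2, fun h3 => hmem ?_⟩⟩
      have := key i (by omega) (by omega)
      rw [mem_greedySet_succ_of_ne (m := x i) (by omega), h1] at this
      exact this.1 h3

theorem not_breaks_of_periodic {x : ℤ → ℕ} {p : ℕ}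
    (h : Function.Periodic (greedyCode x) (p : ℤ)) (n : ℕ) :
    ¬ Breaks x n (greedySet x n) p := by
  rintro ⟨i, h1, h2, h3⟩
  have := h i
  simp only [greedyCode, decide_eq_decide] at this
  rw [mem_greedySet_iff h1, mem_greedySet_iff h2] at h3
  exact h3 this.symm

theorem exists_max_periodic {x : ℤ → ℕ} (h : ¬ Aperiodic (greedyCode x)) :
    ∃ p n : ℕ, 1 ≤ p ∧ Function.Periodic (fun i => max (x i) n) (p : ℤ) := by
  simp only [aperiodic_iff, not_forall, not_not] at h
  have hex : ∃ p : ℕ, 1 ≤ p ∧ ∀ n, ¬ Breaks x n (greedySet x n) p := by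
    obtain ⟨p, hp, hper⟩ := h
    exact ⟨p, hp, not_breaks_of_periodic hper⟩
  obtain ⟨hp, hnot⟩ := Nat.find_spec hex
  have hmin : ∀ q, 1 ≤ q → q < Nat.find hex → ∃ n, Breaks x n (greedySet x n) q := by
    intro q hq hlt
    simpa [hq] using Nat.find_min hex hlt
  generalize Nat.find hex = p at hp hnot hmin
  have hev : ∀ᶠ n in atTop, ∀ q ∈ Set.Iio p, 1 ≤ q → Breaks x n (greedySet x n) q := by
    rw [eventually_all_finite (Set.finite_Iio p)]
    intro q hq
    by_cases hq1 : 1 ≤ q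
    · obtain ⟨n, hn⟩ := hmin q hq1 hq
      exact eventually_atTop.2 ⟨n, fun m hm _ => breaks_mono hm hn⟩
    · exact .of_forall fun n h => absurd h hq1
  obtain ⟨n, hn⟩ := eventually_atTop.1 hev
  refine ⟨p, n, hp, fun i => ?_⟩
  have h1 : n ≤ x i → x i ≤ x (i + p) := fun hi => by
    have := (no_smaller_letter_of_not_breaks hp
      (fun q hq hlt => hn (x i) hi q hlt hq) hnot i).1
    simpa using this
  have h2 : n ≤ x (i + p) → x (i + p) ≤ x i := fun hi => by
    have := (no_smaller_letter_of_not_breaks hp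
      (fun q hq hlt => hn (x (i + p)) hi q hlt hq) hnot i).2
    simpa using this
  show max (x (i + p)) n = max (x i) n
  omega

theorem aperiodic_greedyCode_or_letter {x : ℤ → ℕ} (hx : Aperiodic x) :
    Aperiodic (greedyCode x) ∨ ∃ a, Aperiodic fun i => decide (x i = a) := by
  by_contra! hcon
  obtain ⟨hg, hl⟩ := hcon
  obtain ⟨p, n, hp, hper⟩ := exists_max_periodic hg
  simp only [aperiodic_iff, not_forall, not_not] at hl
  choose P hP1 hP using hl
  rw [aperiodic_iff] at hx
  have hprod : 1 ≤ ∏ a ∈ Finset.range (n + 1), P a :=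
    Nat.succ_le_of_lt (Finset.prod_pos fun a _ => hP1 a)
  refine hx (p * ∏ a ∈ Finset.range (n + 1), P a) (Nat.mul_pos hp hprod) fun i => ?_
  by_cases hi : x i ≤ n
  · obtain ⟨c, hc⟩ := (Finset.dvd_prod_of_mem P (Finset.mem_range.2 (Nat.lt_succ_of_le hi))).mul_left p
    have := (hP (x i)).nat_mul c i
    rw [hc]
    simp only [decide_true, decide_eq_true_eq] at this
    push_cast
    rwa [mul_comm]
  · have := hper.nat_mul (∏ a ∈ Finset.range (n + 1), P a) i
    push_cast at this ⊢
    rw [mul_comm]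
    have : max _ n = max (x i) n := this
    omega

end Greedy

/-- Every aperiodic point has an aperiodic binary factor, chosen in a Borel way. -/
theorem exists_aperiodic_binary_factor (Λ : Type*) [Countable Λ] [MeasurableSpace Λ]
    [DiscreteMeasurableSpace Λ] :
    ∃ φ : (ℤ → Λ) → (ℤ → Bool), IsFactor φ ∧ ∀ x, Aperiodic x → Aperiodic (φ x) := by
  obtain ⟨e, he⟩ := exists_injective_nat Λ
  let φ : ℕ → (ℤ → ℕ) → (ℤ → Bool)
    | 0 => greedyCode
    | a + 1 => fun x i => decide (x i = a)
  have hφ : ∀ n, IsFactor (φ n)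
    | 0 => isFactor_greedyCode
    | a + 1 => ⟨measurable_of_forall_prop fun i => by
        simpa [φ] using measurable_letter (q := (· = a)) i, fun x => rfl⟩
  have hcode : IsFactor fun (x : ℤ → Λ) i => e (x i) :=
    ⟨measurable_pi_iff.2 fun i => (Measurable.of_discrete (f := e)).comp (measurable_pi_apply i),
      fun x => rfl⟩
  obtain ⟨ψ, hψ, hψP⟩ := exists_factor_choice measurable_aperiodic (fun _ => aperiodic_shift) hφ
  refine ⟨_, hψ.comp hcode, fun x hx => ?_⟩
  have hex : Aperiodic fun i => e (x i) := by
    rw [aperiodic_iff] at hx ⊢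
    exact fun p hp h => hx p hp fun i => he (h i)
  obtain ⟨n, hn, hn'⟩ := hψP (fun i => e (x i)) (by
    rcases aperiodic_greedyCode_or_letter hex with h | ⟨a, h⟩
    · exact ⟨0, h⟩
    · exact ⟨a + 1, h⟩)
  rwa [hn]

section Sparse

/-- The endpoints of the runs of step `s` in `y`. -/
def runEnds (s : ℤ) (y : ℤ → Bool) (i : ℤ) : Bool := y i && !y (i + s)

theorem isFactor_runEnds (s : ℤ) : IsFactor (runEnds s) := by
  constructor
  · refine measurable_pi_iff.2 fun i => ?_
    have hpair : Measurable fun y : ℤ → Bool => (y i, y (i + s)) :=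
      (measurable_pi_apply i).prodMk (measurable_pi_apply (i + s))
    exact (Measurable.of_discrete (f := fun b : Bool × Bool => b.1 && !b.2)).comp hpair
  · intro y
    funext i
    simp only [runEnds, shift, add_right_comm]

theorem isSeparated_runEnds {g : ℕ} {s : ℤ} (hs : |s| = g) {y : ℤ → Bool}
    (h : IsSeparated g y) : IsSeparated (g + 1) (runEnds s y) := by
  intro i j hi hj hij
  simp only [runEnds, Bool.and_eq_true, Bool.not_eq_true'] at hi hj
  have h1 := h i j hi.1 hj.1 hij
  have h2 : i - j ≠ s := fun h2 => by
    rw [← h2, add_sub_cancel, hi.1] at hj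
    simp at hj
  have h3 : j - i ≠ s := fun h3 => by
    rw [← h3, add_sub_cancel, hj.1] at hi
    simp at hi
  have h4 : |i - j| ≠ g := by
    rw [← hs]
    intro h4
    rcases abs_eq_abs.1 h4 with h | h <;> omega
  push_cast
  omega

/-- A binary sequence whose rises and falls have period `p` has period `p`. -/
theorem periodic_of_rises_falls {b : ℤ → Bool} {p : ℤ}
    (hfall : Function.Periodic (fun k => b k && !b (k + 1)) p)
    (hrise : Function.Periodic (fun k => b (k + 1) && !b k) p) : Function.Periodic b p := by
  have hfall' (k : ℤ) : (b (k + p) && !b (k + 1 + p)) = (b k && !b (k + 1)) := by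
    simpa only [add_right_comm] using hfall k
  have hrise' (k : ℤ) : (b (k + 1 + p) && !b (k + p)) = (b (k + 1) && !b k) := by
    simpa only [add_right_comm] using hrise k
  have hstep : ∀ k, b (k + p) = b k ↔ b (k + 1 + p) = b (k + 1) := by
    intro k
    have h1 := hfall' k
    have h2 := hrise' k
    revert h1 h2
    cases b k <;> cases b (k + 1) <;> cases b (k + p) <;> cases b (k + 1 + p) <;> simp
  by_cases hconst : ∀ k, b (k + 1) = b k
  · have h0 : ∀ k, b k = b 0 := by
      intro k
      induction k with
      | zero => rfl
      | succ k ih => rw [hconst, ih]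
      | pred k ih => rw [← hconst, sub_add_cancel, ih]
    intro k
    rw [h0, h0 k]
  · push Not at hconst
    obtain ⟨m, hm⟩ := hconst
    have hbase : b (m + p) = b m := by
      have h1 := hfall' m
      have h2 := hrise' m
      revert h1 h2 hm
      cases b m <;> cases b (m + 1) <;> cases b (m + p) <;> cases b (m + 1 + p) <;> simp
    have hall : ∀ k, b (m + k + p) = b (m + k) := by
      intro k
      induction k with
      | zero => simpa using hbase
      | succ k ih => simpa only [add_assoc] using (hstep _).1 ih
      | pred k ih =>
        refine (hstep _).2 ?_
        convert ih using 2 <;> ring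
    intro k
    simpa using hall (k - m)

theorem aperiodic_runEnds {g : ℕ} (hg : 1 ≤ g) {y : ℤ → Bool} (hy : Aperiodic y) :
    Aperiodic (runEnds g y) ∨ Aperiodic (runEnds (-g) y) := by
  by_contra! hcon
  simp only [aperiodic_iff, not_forall, not_not] at hcon hy
  obtain ⟨⟨p, hp, hpp⟩, ⟨q, hq, hqq⟩⟩ := hcon
  refine hy (g * (p * q)) (Nat.mul_pos hg (Nat.mul_pos hp hq)) fun i => ?_
  have key : Function.Periodic (fun k : ℤ => y (i + g * k)) ((p * q : ℕ) : ℤ) := by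
    apply periodic_of_rises_falls
    · intro k
      have := hpp.nat_mul (g * q) (i + g * k)
      simp only [runEnds] at this
      convert this using 3 <;> push_cast <;> ring_nf
    · intro k
      have := hqq.nat_mul (g * p) (i + g * (k + 1))
      simp only [runEnds] at this
      convert this using 3 <;> push_cast <;> ring_nf
  simpa using key 0

/-- Aperiodic binary sequences have arbitrarily separated aperiodic factors. -/
theorem exists_separated_factor (g : ℕ) :
    ∃ φ : (ℤ → Bool) → (ℤ → Bool), IsFactor φ ∧
      ∀ y, Aperiodic y → Aperiodic (φ y) ∧ IsSeparated (g + 1) (φ y) := by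
  induction g with
  | zero =>
    refine ⟨id, ⟨measurable_id, fun _ => rfl⟩, fun y hy => ⟨hy, fun i j _ _ hij => ?_⟩⟩
    have := abs_pos.2 (sub_ne_zero.2 hij)
    push_cast
    omega
  | succ g ih =>
    obtain ⟨φ, hφ, hφP⟩ := ih
    let s : ℕ → ℤ := fun n => if n = 0 then ((g + 1 : ℕ) : ℤ) else -((g + 1 : ℕ) : ℤ)
    have hs : ∀ n, |s n| = ((g + 1 : ℕ) : ℤ) := by
      intro n
      simp only [s]
      split_ifs
      · exact abs_of_nonneg (by positivity)
      · rw [abs_neg]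
        exact abs_of_nonneg (by positivity)
    obtain ⟨ψ, hψ, hψP⟩ := exists_factor_choice measurable_aperiodic (fun _ => aperiodic_shift)
      (fun n => (isFactor_runEnds (s n)).comp hφ)
    refine ⟨ψ, hψ, fun y hy => ?_⟩
    obtain ⟨hap, hsep⟩ := hφP y hy
    obtain ⟨n, hn, hn'⟩ := hψP y (by
      rcases aperiodic_runEnds (Nat.succ_pos g) hap with h | h
      · exact ⟨0, by simpa [s] using h⟩
      · exact ⟨1, by simpa [s] using h⟩)
    rw [hn]
    exact ⟨hn', isSeparated_runEnds (hs n) hsep⟩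

end Sparse

section Unbounded

/-- The positions of `1`s in `y` are unbounded in both directions. -/
def TwoSided (y : ℤ → Bool) : Prop :=
  ∀ i : ℤ, (∃ j, i < j ∧ y j = true) ∧ ∃ j, j ≤ i ∧ y j = true

/-- All multiples of `M` other than `0`, counted from an extremal `1` of `y`: the last one for
`s = 1`, the first one for `s = -1`. -/
noncomputable def extremalComb (M : ℕ) (s : ℤ) (y : ℤ → Bool) (i : ℤ) : Bool :=
  decide (∃ j : ℤ, y j = true ∧ (∀ k, 0 < s * (k - j) → y k = false) ∧ (M : ℤ) ∣ i - j ∧ i ≠ j)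

theorem forall_int_shift {P : ℤ → Prop} : (∀ i, P (i + 1)) ↔ ∀ i, P i :=
  ⟨fun h i => by simpa using h (i - 1), fun h i => h (i + 1)⟩

theorem measurable_bool_eq (i : ℤ) (b : Bool) : Measurable fun y : ℤ → Bool => y i = b :=
  (Measurable.of_discrete (f := fun c : Bool => c = b)).comp (measurable_pi_apply i)

theorem isFactor_extremalComb (M : ℕ) (s : ℤ) : IsFactor (extremalComb M s) := by
  constructor
  · refine measurable_of_forall_prop fun i => ?_
    simp only [extremalComb, decide_eq_true_eq]
    exact .exists fun j => (measurable_bool_eq j true).and <|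
      .and (.forall fun k => .imp measurable_const (measurable_bool_eq k false)) measurable_const
  · intro y
    funext i
    change extremalComb M s (shift y) i = extremalComb M s y (i + 1)
    rw [Bool.eq_iff_iff]
    simp only [extremalComb, decide_eq_true_eq]
    simp only [shift]
    rw [← exists_int_shift (P := fun j => y j = true ∧ (∀ k, 0 < s * (k - j) → y k = false) ∧
      (M : ℤ) ∣ i + 1 - j ∧ i + 1 ≠ j)]
    refine exists_congr fun j => and_congr_right fun _ => and_congr ?_ ?_
    · rw [← forall_int_shift (P := fun k => 0 < s * (k - (j + 1)) → y k = false)]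
      simp only [add_sub_add_right_eq_sub]
    · simp only [add_sub_add_right_eq_sub, ne_eq, add_left_inj]

theorem extremalComb_eq {M : ℕ} {s : ℤ} (hs : s ≠ 0) {y : ℤ → Bool} {j : ℤ} (hj : y j = true)
    (hext : ∀ k, 0 < s * (k - j) → y k = false) (i : ℤ) :
    extremalComb M s y i = true ↔ (M : ℤ) ∣ i - j ∧ i ≠ j := by
  simp only [extremalComb, decide_eq_true_eq]
  refine ⟨?_, fun h => ⟨j, hj, hext, h⟩⟩
  rintro ⟨j', hj', hext', h⟩
  have : j' = j := by
    by_contra hne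
    rcases lt_or_gt_of_ne (mul_ne_zero hs (sub_ne_zero.2 hne)) with hlt | hlt
    · have := hext' j (by linarith)
      simp_all
    · have := hext j' hlt
      simp_all
  rwa [this] at h

theorem isSeparated_extremalComb {M : ℕ} {s : ℤ} (hs : s ≠ 0) {y : ℤ → Bool} :
    IsSeparated M (extremalComb M s y) := by
  intro i i' hi hi' hne
  obtain ⟨j, hj, hext, -⟩ := of_decide_eq_true hi
  rw [extremalComb_eq hs hj hext] at hi hi'
  refine Int.le_of_dvd (abs_pos.2 (sub_ne_zero.2 hne)) ((dvd_abs _ _).2 ?_)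
  simpa using dvd_sub hi.1 hi'.1

theorem extremalComb_spec {M : ℕ} (hM : 1 ≤ M) {s : ℤ} (hs : s ≠ 0) {y : ℤ → Bool} {j : ℤ}
    (hj : y j = true) (hext : ∀ k, 0 < s * (k - j) → y k = false) :
    Aperiodic (extremalComb M s y) ∧ TwoSided (extremalComb M s y) := by
  have hiff := extremalComb_eq (M := M) hs hj hext
  have hM' : (1 : ℤ) ≤ M := by exact_mod_cast hM
  constructor
  · rw [aperiodic_iff]
    intro p hp h
    have h1 := h.nat_mul M j
    have h2 : extremalComb M s y j ≠ true := by simp [hiff]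
    rw [← h1, Ne, hiff] at h2
    refine h2 ⟨by simp, ?_⟩
    have : 0 < (M : ℤ) * p := by positivity
    omega
  · intro i
    have habs := abs_nonneg (i - j)
    have h1 := le_abs_self (i - j)
    have h2 := neg_abs_le (i - j)
    have h3 : |i - j| + 1 ≤ M * (|i - j| + 1) := by nlinarith
    refine ⟨⟨j + M * (|i - j| + 1), by omega, (hiff _).2 ⟨by simp, by omega⟩⟩,
      ⟨j - M * (|i - j| + 1), by omega, (hiff _).2 ⟨?_, by omega⟩⟩⟩
    rw [sub_sub_cancel_left]
    exact (dvd_mul_right _ _).neg_right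

theorem twoSided_shift {y : ℤ → Bool} : TwoSided (shift y) ↔ TwoSided y := by
  unfold TwoSided
  rw [← forall_int_shift (P := fun i => (∃ j, i < j ∧ y j = true) ∧ ∃ j, j ≤ i ∧ y j = true)]
  refine forall_congr' fun i => ?_
  rw [← exists_int_shift (P := fun j => i + 1 < j ∧ y j = true),
    ← exists_int_shift (P := fun j => j ≤ i + 1 ∧ y j = true)]
  simp only [shift, add_lt_add_iff_right, add_le_add_iff_right]

theorem measurable_twoSided : Measurable TwoSided :=
  .forall fun _ => .and (.exists fun j => measurable_const.and (measurable_bool_eq j true))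
    (.exists fun j => measurable_const.and (measurable_bool_eq j true))

theorem exists_last_of_bounded {y : ℤ → Bool} {i j : ℤ} (hj : y j = true)
    (hi : ∀ k, i < k → y k = false) : ∃ m, y m = true ∧ ∀ k, m < k → y k = false := by
  obtain ⟨m, hm, hmax⟩ := Int.exists_greatest_of_bdd (P := fun k => y k = true)
    ⟨i, fun k hk => by
      by_contra hlt
      simp [hi k (by omega)] at hk⟩ ⟨j, hj⟩
  refine ⟨m, hm, fun k hk => ?_⟩
  by_contra hk'
  have := hmax k (by simpa using hk')
  omega

theorem exists_first_of_bounded {y : ℤ → Bool} {i j : ℤ} (hj : y j = true)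
    (hi : ∀ k, k ≤ i → y k = false) : ∃ m, y m = true ∧ ∀ k, k < m → y k = false := by
  obtain ⟨m, hm, hmin⟩ := Int.exists_least_of_bdd (P := fun k => y k = true)
    ⟨i, fun k hk => by
      by_contra hlt
      simp [hi k (by omega)] at hk⟩ ⟨j, hj⟩
  refine ⟨m, hm, fun k hk => ?_⟩
  by_contra hk'
  have := hmin k (by simpa using hk')
  omega

theorem exists_twoSided_factor {M : ℕ} (hM : 1 ≤ M) :
    ∃ φ : (ℤ → Bool) → (ℤ → Bool), IsFactor φ ∧ ∀ y, Aperiodic y → IsSeparated M y →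
      Aperiodic (φ y) ∧ TwoSided (φ y) ∧ IsSeparated M (φ y) := by
  let φ : ℕ → (ℤ → Bool) → (ℤ → Bool)
    | 0 => id
    | 1 => extremalComb M 1
    | _ => extremalComb M (-1)
  have hφ : ∀ n, IsFactor (φ n)
    | 0 => ⟨measurable_id, fun _ => rfl⟩
    | 1 => isFactor_extremalComb M 1
    | _ + 2 => isFactor_extremalComb M (-1)
  have hsep : ∀ n y, IsSeparated M y → IsSeparated M (φ n y)
    | 0, _, h => h
    | 1, _, _ => isSeparated_extremalComb (by norm_num)
    | _ + 2, _, _ => isSeparated_extremalComb (by norm_num)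
  obtain ⟨ψ, hψ, hψP⟩ := exists_factor_choice (P := fun y => Aperiodic y ∧ TwoSided y)
    (measurable_aperiodic.and measurable_twoSided)
    (fun y => and_congr aperiodic_shift twoSided_shift) hφ
  refine ⟨ψ, hψ, fun y hy hys => ?_⟩
  obtain ⟨n, hn, hn', hn''⟩ := hψP y (by
    by_cases htwo : TwoSided y
    · exact ⟨0, hy, htwo⟩
    obtain ⟨j, hj⟩ : ∃ j, y j = true := by
      by_contra! hno
      refine aperiodic_iff.1 hy 1 le_rfl fun i => ?_
      rw [Bool.eq_false_of_not_eq_true (hno _), Bool.eq_false_of_not_eq_true (hno _)]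
    simp only [TwoSided, not_forall, not_and_or (a := ∃ _, _), not_exists, not_and,
      Bool.not_eq_true] at htwo
    obtain ⟨i, hi | hi⟩ := htwo
    · obtain ⟨m, hm, hlast⟩ := exists_last_of_bounded hj hi
      exact ⟨1, extremalComb_spec hM (by norm_num) hm fun k hk => hlast k (by linarith)⟩
    · obtain ⟨m, hm, hfirst⟩ := exists_first_of_bounded hj hi
      exact ⟨2, extremalComb_spec hM (by norm_num) hm fun k hk => hfirst k (by linarith)⟩)
  rw [hn]
  exact ⟨hn', hn'', hsep n y hys⟩

end Unbounded

section Fill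

/-- The number, between `1` and `N`, of gaps `N + 1` used to fill an interval of length `g`. -/
def longGaps (N : ℕ) (g : ℤ) : ℤ := (g - 1) % N + 1

/-- The marker positions `d` in an interval of length `g`: first `longGaps N g` gaps of length
`N + 1`, then gaps of length `N`. -/
def IsFillPos (N : ℕ) (g d : ℤ) : Prop :=
  (d ≤ longGaps N g * (N + 1) ∧ (N + 1 : ℤ) ∣ d) ∨ (longGaps N g * (N + 1) ≤ d ∧ (N : ℤ) ∣ g - d)

/-- `j` and `k` are consecutive positions of `1`s in `y`. -/
def Consecutive (y : ℤ → Bool) (j k : ℤ) : Prop :=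
  j < k ∧ y j = true ∧ y k = true ∧ ∀ m, j < m → m < k → y m = false

/-- The sequence obtained from `y` by filling the intervals between consecutive `1`s. -/
noncomputable def fill (N : ℕ) (y : ℤ → Bool) (i : ℤ) : Bool :=
  decide (∃ j k : ℤ, Consecutive y j k ∧ j ≤ i ∧ i < k ∧ IsFillPos N (k - j) (i - j))

theorem consecutive_shift {y : ℤ → Bool} {j k : ℤ} :
    Consecutive (shift y) j k ↔ Consecutive y (j + 1) (k + 1) := by
  simp only [Consecutive, shift, add_lt_add_iff_right]
  rw [← forall_int_shift (P := fun m => j + 1 < m → m < k + 1 → y m = false)]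
  simp only [add_lt_add_iff_right]

theorem isFactor_fill (N : ℕ) : IsFactor (fill N) := by
  constructor
  · refine measurable_of_forall_prop fun i => ?_
    simp only [fill, decide_eq_true_eq]
    refine .exists fun j => .exists fun k => .and ?_ measurable_const
    exact measurable_const.and <| (measurable_bool_eq j true).and <|
      (measurable_bool_eq k true).and <| .forall fun m =>
        .imp measurable_const (.imp measurable_const (measurable_bool_eq m false))
  · intro y
    funext i
    simp only [fill, consecutive_shift]
    simp only [shift, fill, decide_eq_decide]
    rw [← exists_int_shift (P := fun j => ∃ k : ℤ, Consecutive y j k ∧ j ≤ i + 1 ∧ i + 1 < k ∧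
      IsFillPos N (k - j) (i + 1 - j))]
    refine exists_congr fun j => ?_
    rw [← exists_int_shift (P := fun k => Consecutive y (j + 1) k ∧ j + 1 ≤ i + 1 ∧ i + 1 < k ∧
      IsFillPos N (k - (j + 1)) (i + 1 - (j + 1)))]
    simp only [add_le_add_iff_right, add_lt_add_iff_right, add_sub_add_right_eq_sub]

theorem longGaps_spec {N : ℕ} (hN : 1 ≤ N) (g : ℤ) :
    1 ≤ longGaps N g ∧ longGaps N g ≤ N ∧ (N : ℤ) ∣ g - longGaps N g * (N + 1) := by
  have hN' : (0 : ℤ) < N := by exact_mod_cast hN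
  have h1 := Int.emod_nonneg (g - 1) hN'.ne'
  have h2 := Int.emod_lt_of_pos (g - 1) hN'
  refine ⟨by unfold longGaps; omega, by unfold longGaps; omega,
    ⟨(g - 1) / N - longGaps N g, ?_⟩⟩
  have h3 := Int.emod_add_mul_ediv (g - 1) N
  unfold longGaps
  linear_combination -h3

theorem Consecutive.unique {y : ℤ → Bool} {j k j' k' i : ℤ} (h : Consecutive y j k)
    (h' : Consecutive y j' k') (hi : j ≤ i) (hi2 : i < k) (hi' : j' ≤ i) (hi2' : i < k') :
    j = j' ∧ k = k' := by
  obtain ⟨_, hj, hk, hb⟩ := h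
  obtain ⟨_, hj', hk', hb'⟩ := h'
  constructor
  · rcases lt_trichotomy j j' with hlt | heq | hlt
    · simp [hb j' hlt (by omega)] at hj'
    · exact heq
    · simp [hb' j hlt (by omega)] at hj
  · rcases lt_trichotomy k k' with hlt | heq | hlt
    · simp [hb' k (by omega) hlt] at hk
    · exact heq
    · simp [hb k' (by omega) hlt] at hk'

theorem TwoSided.exists_consecutive {y : ℤ → Bool} (h : TwoSided y) (i : ℤ) :
    ∃ j k, Consecutive y j k ∧ j ≤ i ∧ i < k := by
  obtain ⟨⟨k₀, hk₀, hyk₀⟩, ⟨j₀, hj₀, hyj₀⟩⟩ := h i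
  obtain ⟨j, ⟨hj, hyj⟩, hmax⟩ := Int.exists_greatest_of_bdd
    (P := fun j => j ≤ i ∧ y j = true) ⟨i, fun k hk => hk.1⟩ ⟨j₀, hj₀, hyj₀⟩
  obtain ⟨k, ⟨hk, hyk⟩, hmin⟩ := Int.exists_least_of_bdd
    (P := fun k => i < k ∧ y k = true) ⟨i, fun k hk => hk.1.le⟩ ⟨k₀, hk₀, hyk₀⟩
  refine ⟨j, k, ⟨by omega, hyj, hyk, fun m hm hm' => ?_⟩, hj, hk⟩
  by_contra hne
  rw [Bool.not_eq_false] at hne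
  by_cases hmi : m ≤ i
  · have := hmax m ⟨hmi, hne⟩
    omega
  · have := hmin m ⟨by omega, hne⟩
    omega

theorem TwoSided.fill_of_eq_true {N : ℕ} {y : ℤ → Bool} (h : TwoSided y) (hN : 1 ≤ N) {i : ℤ}
    (hi : y i = true) : fill N y i = true := by
  obtain ⟨j, k, hjk, hji, hik⟩ := h.exists_consecutive i
  have hij : i = j := by
    by_contra hne
    simp [hjk.2.2.2 i (by omega) hik] at hi
  subst hij
  have hc := (longGaps_spec hN (k - i)).1
  exact decide_eq_true ⟨i, k, hjk, hji, hik, Or.inl ⟨by rw [sub_self]; positivity, by simp⟩⟩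

/-- On a closed interval between consecutive `1`s of `y`, the filled sequence is given by the
fill positions. -/
theorem TwoSided.fill_iff {N : ℕ} {y : ℤ → Bool} (h : TwoSided y) (hN : 1 ≤ N) {j k : ℤ}
    (hjk : Consecutive y j k) (hM : longGaps N (k - j) * (N + 1) ≤ k - j)
    {d : ℤ} (hd : 0 ≤ d) (hd' : d ≤ k - j) :
    fill N y (j + d) = true ↔ IsFillPos N (k - j) d := by
  rcases hd'.lt_or_eq with hlt | rfl
  · constructor
    · intro hf
      obtain ⟨j', k', hjk', h1, h2, h3⟩ := of_decide_eq_true hf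
      obtain ⟨rfl, rfl⟩ := hjk.unique hjk' (by omega) (by omega) h1 h2
      simpa using h3
    · intro hp
      exact decide_eq_true ⟨j, k, hjk, by omega, by omega, by simpa using hp⟩
  · rw [add_sub_cancel]
    exact iff_of_true (h.fill_of_eq_true hN hjk.2.2.1) (Or.inr ⟨hM, by simp⟩)

theorem IsFillPos.le_sub {N : ℕ} (hN : 1 ≤ N) {g d d' : ℤ} (h : IsFillPos N g d)
    (h' : IsFillPos N g d') (hlt : d < d') : (N : ℤ) ≤ d' - d := by
  obtain ⟨-, -, hg⟩ := longGaps_spec hN g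
  have hC : (N + 1 : ℤ) ∣ longGaps N g * (N + 1) := dvd_mul_left _ _
  unfold IsFillPos at h h'
  generalize longGaps N g * (N + 1) = C at *
  rcases h with ⟨h1, h2⟩ | ⟨h1, h2⟩ <;> rcases h' with ⟨h1', h2'⟩ | ⟨h1', h2'⟩
  · have := Int.le_of_dvd (by omega) (dvd_sub h2' h2)
    omega
  · rcases h1.lt_or_eq with h3 | rfl
    · have := Int.le_of_dvd (by omega) (dvd_sub hC h2)
      omega
    · have := Int.le_of_dvd (by omega) (dvd_sub hg h2')
      omega
  · omega
  · have := Int.le_of_dvd (by omega) (dvd_sub h2 h2')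
    omega

theorem emod_le_self_of_nonneg {a b : ℤ} (ha : 0 ≤ a) (hb : 0 ≤ b) : a % b ≤ a := by
  have h1 := Int.emod_add_mul_ediv a b
  have h2 := mul_nonneg hb (Int.ediv_nonneg ha hb)
  omega

theorem exists_isFillPos {N : ℕ} (hN : 1 ≤ N) {g d : ℤ}
    (hM : longGaps N g * (N + 1) ≤ g) (hd : d ≤ g) :
    ∃ d', d ≤ d' ∧ d' ≤ d + N ∧ d' ≤ g ∧ IsFillPos N g d' := by
  have hC : (N + 1 : ℤ) ∣ longGaps N g * (N + 1) := dvd_mul_left _ _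
  unfold IsFillPos
  generalize longGaps N g * (N + 1) = C at *
  have hN' : (0 : ℤ) < N := by exact_mod_cast hN
  by_cases hdC : d ≤ C
  · have h1 := Int.emod_nonneg (C - d) (b := N + 1) (by omega)
    have h2 := Int.emod_lt_of_pos (C - d) (b := N + 1) (by omega)
    have h3 : (C - d) % (N + 1) ≤ C - d := emod_le_self_of_nonneg (by omega) (by omega)
    refine ⟨d + (C - d) % (N + 1), by omega, by omega, by omega, Or.inl ⟨by omega, ?_⟩⟩
    have h4 := dvd_sub hC (Int.dvd_self_sub_emod (x := C - d) (m := (N + 1 : ℤ)))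
    rwa [← sub_add, sub_sub_cancel] at h4
  · have h1 := Int.emod_nonneg (g - d) hN'.ne'
    have h2 := Int.emod_lt_of_pos (g - d) hN'
    have h3 : (g - d) % N ≤ g - d := emod_le_self_of_nonneg (by omega) (by omega)
    refine ⟨d + (g - d) % N, by omega, by omega, by omega, Or.inr ⟨by omega, ?_⟩⟩
    rw [← sub_sub]
    exact Int.dvd_self_sub_emod

/-- The intervals between the `1`s of a sparse sequence are long enough to be filled. -/
theorem IsSeparated.longGaps_le {N : ℕ} (hN : 1 ≤ N) {y : ℤ → Bool}
    (h : IsSeparated (N * N + 2 * N) y) {j k : ℤ} (hjk : Consecutive y j k) :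
    longGaps N (k - j) * (N + 1) + N ≤ k - j := by
  have h1 := h k j hjk.2.2.1 hjk.2.1 hjk.1.ne'
  rw [abs_of_pos (sub_pos.2 hjk.1)] at h1
  obtain ⟨-, h2, -⟩ := longGaps_spec hN (k - j)
  push_cast at h1
  nlinarith

section Filled

variable {N : ℕ} {y : ℤ → Bool}

theorem isSeparated_fill (hN : 1 ≤ N) (htwo : TwoSided y)
    (hsep : IsSeparated (N * N + 2 * N) y) : IsSeparated N (fill N y) := by
  have key : ∀ i i' : ℤ, fill N y i = true → fill N y i' = true → i < i' → (N : ℤ) ≤ i' - i := by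
    intro i i' hi hi' hlt
    obtain ⟨j, k, hjk, hji, hik⟩ := htwo.exists_consecutive i
    have hM := hsep.longGaps_le hN hjk
    have hiff := fun d => htwo.fill_iff hN hjk (by omega) (d := d)
    have h1 : IsFillPos N (k - j) (i - j) := by
      rw [← hiff _ (by omega) (by omega), add_sub_cancel]
      exact hi
    by_cases hk : i' ≤ k
    · have h2 : IsFillPos N (k - j) (i' - j) := by
        rw [← hiff _ (by omega) (by omega), add_sub_cancel]
        exact hi'
      have := h1.le_sub hN h2 (by omega)
      omega
    · have h2 : IsFillPos N (k - j) (k - j) := Or.inr ⟨by omega, by simp⟩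
      have := h1.le_sub hN h2 (by omega)
      omega
  intro i i' hi hi' hne
  rcases lt_or_gt_of_ne hne with h | h
  · rw [abs_sub_comm, abs_of_pos (by omega)]
    exact key i i' hi hi' h
  · rw [abs_of_pos (by omega)]
    exact key i' i hi' hi h

theorem isDense_fill (hN : 1 ≤ N) (htwo : TwoSided y)
    (hsep : IsSeparated (N * N + 2 * N) y) : IsDense' N (fill N y) := by
  intro i
  obtain ⟨j, k, hjk, hji, hik⟩ := htwo.exists_consecutive i
  have hM := hsep.longGaps_le hN hjk
  obtain ⟨d, h1, h2, h3, h4⟩ := exists_isFillPos hN (g := k - j) (d := i - j)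
    (by omega) (by omega)
  exact ⟨j + d, ⟨by omega, by omega⟩,
    (htwo.fill_iff hN hjk (by omega) (by omega) (by omega)).2 h4⟩

/-- The filled sequence determines the original one: its `1`s are the places where a gap `N` is
followed by a gap `N + 1`. -/
theorem eq_true_iff_fill (hN : 1 ≤ N) (htwo : TwoSided y)
    (hsep : IsSeparated (N * N + 2 * N) y) (i : ℤ) :
    y i = true ↔
      fill N y i = true ∧ fill N y (i - N) = true ∧ fill N y (i + N) = false := by
  have hN' : (1 : ℤ) ≤ N := by exact_mod_cast hN
  have hndvd : ∀ d : ℤ, (N + 1 : ℤ) ∣ d → ¬ (N + 1 : ℤ) ∣ d + N := by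
    intro d h1 h2
    have := Int.le_of_dvd (by omega) ((dvd_add_right h1).1 h2)
    omega
  obtain ⟨j, k, hjk, hji, hik⟩ := htwo.exists_consecutive i
  have hM := hsep.longGaps_le hN hjk
  have hc := (longGaps_spec hN (k - j)).1
  have hC : (N + 1 : ℤ) ≤ longGaps N (k - j) * (N + 1) := by nlinarith
  have hiff := fun d => htwo.fill_iff hN hjk (by omega) (d := d)
  constructor
  · intro hi
    have hij : i = j := by
      by_contra hne
      simp [hjk.2.2.2 i (by omega) hik] at hi
    subst hij
    refine ⟨htwo.fill_of_eq_true hN hi, ?_, ?_⟩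
    · obtain ⟨j', k', hjk', hji', hik'⟩ := htwo.exists_consecutive (i - 1)
      have hk' : k' = i := by
        by_contra hne
        simp [hjk'.2.2.2 i (by omega) (by omega)] at hi
      subst hk'
      have hM' := hsep.longGaps_le hN hjk'
      have hc' := (longGaps_spec hN (k' - j')).1
      have hC' : 0 ≤ longGaps N (k' - j') * (N + 1) := by positivity
      have := (htwo.fill_iff hN hjk' (d := k' - j' - N) (by omega) (by omega) (by omega)).2
        (Or.inr ⟨by omega, by simp⟩)
      convert this using 2
      ring
    · rw [← Bool.not_eq_true, hiff N (by omega) (by omega)]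
      rintro (⟨-, h⟩ | ⟨h, -⟩)
      · exact hndvd 0 (dvd_zero _) (by simpa using h)
      · omega
  · rintro ⟨h1, h2, h3⟩
    by_contra hyi
    have hne : i ≠ j := by
      rintro rfl
      exact hyi hjk.2.1
    have hpos : IsFillPos N (k - j) (i - j) := by
      rw [← hiff _ (by omega) (by omega), add_sub_cancel]
      exact h1
    by_cases hlt : i - j < longGaps N (k - j) * (N + 1)
    · rcases hpos with ⟨-, hdvd⟩ | ⟨h, -⟩
      · have := Int.le_of_dvd (by omega) hdvd
        have hprev : IsFillPos N (k - j) (i - j - N) := by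
          rw [← hiff _ (by omega) (by omega)]
          convert h2 using 2
          ring
        rcases hprev with ⟨-, h⟩ | ⟨h, -⟩
        · exact hndvd _ h (by simpa using hdvd)
        · omega
      · omega
    · have hdvd : (N : ℤ) ∣ k - j - (i - j) := by
        rcases hpos with ⟨h, -⟩ | ⟨-, h⟩
        · rw [show i - j = longGaps N (k - j) * (N + 1) by omega]
          exact (longGaps_spec hN (k - j)).2.2
        · exact h
      have hle := Int.le_of_dvd (by omega) hdvd
      have hnext := (hiff (i - j + N) (by omega) (by omega)).2
        (Or.inr ⟨by omega, by
          rw [← sub_sub]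
          exact dvd_sub_self_right.2 hdvd⟩)
      rw [← add_assoc, add_sub_cancel, h3] at hnext
      simp at hnext

theorem aperiodic_fill (hN : 1 ≤ N) (htwo : TwoSided y)
    (hsep : IsSeparated (N * N + 2 * N) y) (hy : Aperiodic y) : Aperiodic (fill N y) := by
  rw [aperiodic_iff] at hy ⊢
  intro p hp h
  refine hy p hp fun i => ?_
  rw [Bool.eq_iff_iff, eq_true_iff_fill hN htwo hsep, eq_true_iff_fill hN htwo hsep,
    add_sub_right_comm, add_right_comm, h, h, h]

end Filled

end Fill

/-- **Aperiodic marker lemma.** For a countable alphabet `Λ` and every `N ≥ 1` there is a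
factor map `π : Λ_AP^ℤ → {0,1}^ℤ` whose image consists of aperiodic `N`-markers
(`N`-separated and `(N+1)`-dense sequences). -/
theorem aperiodic_marker_factor {Λ : Type*} [Countable Λ]
    [MeasurableSpace Λ] [DiscreteMeasurableSpace Λ] (N : ℕ) (hN : 1 ≤ N) :
    ∃ π : (ℤ → Λ) → (ℤ → Bool),
      Measurable π ∧
      ∀ x : ℤ → Λ, Aperiodic x →
        π (shift x) = shift (π x) ∧
        Aperiodic (π x) ∧
        IsSeparated N (π x) ∧
        IsDense' N (π x) := by
  obtain ⟨φ, hφ, hφP⟩ := exists_aperiodic_binary_factor Λ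
  obtain ⟨ψ, hψ, hψP⟩ := exists_separated_factor (N * N + 2 * N - 1)
  rw [Nat.sub_add_cancel (by omega)] at hψP
  obtain ⟨χ, hχ, hχP⟩ := exists_twoSided_factor (M := N * N + 2 * N) (by omega)
  have hπ := (isFactor_fill N).comp (hχ.comp (hψ.comp hφ))
  refine ⟨_, hπ.measurable, fun x hx => ⟨hπ.equivariant x, ?_⟩⟩
  obtain ⟨hap, hsep⟩ := hψP _ (hφP x hx)
  obtain ⟨hap', htwo, hsep'⟩ := hχP _ hap hsep
  exact ⟨aperiodic_fill hN htwo hsep' hap', isSeparated_fill hN htwo hsep',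
    isDense_fill hN htwo hsep'⟩
end

section
/- Let Σ be a countable alphabet. There is a Borel measurable map assigning to each y ∈ Σ_AP^ℤ, each I ⊆ ℤ, and each pair of reals 0 ≤ t₁ < t₂ ≤ 1, a subset J = J(y, I, t₁, t₂) ⊆ I, such that the assignment is equivariant in the sense that (Sy, SI, t₁, t₂) is sent to SJ, and such that s̲(J) ≥ t₁·s̲(I) and s̲(I∖J) ≥ (1−t₂)·s̲(I), and likewise s̄(J) ≥ t₁·s̄(I) and s̄(I∖J) ≥ (1−t₂)·s̄(I). -/
open Filter
open scoped Classical

/-- The shift on subsets of `ℤ`: `SI = I − 1 = {i : i + 1 ∈ I}`. -/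
def shiftSet (I : Set ℤ) : Set ℤ := {i | i + 1 ∈ I}

/-- The lower density of `I ⊆ ℤ`: `liminf_N (1/N)·|I ∩ [0,N−1]|`. -/
noncomputable def lowerDensity (I : Set ℤ) : ℝ :=
  liminf (fun N : ℕ => (∑ i ∈ Finset.range N, if (i : ℤ) ∈ I then (1 : ℝ) else 0) / N) atTop

/-- The upper density of `I ⊆ ℤ`: `limsup_N (1/N)·|I ∩ [0,N−1]|`. -/
noncomputable def upperDensity (I : Set ℤ) : ℝ :=
  limsup (fun N : ℕ => (∑ i ∈ Finset.range N, if (i : ℤ) ∈ I then (1 : ℝ) else 0) / N) atTop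

/-- Number of elements of `I` in `[a, b)`. -/
noncomputable def count (I : Set ℤ) (a b : ℤ) : ℝ :=
  ∑ k ∈ Finset.Ico a b, if k ∈ I then (1 : ℝ) else 0

/-- Finite patterns over the alphabet `Λ × Prop`, placed on a window `[-n, n]`. -/
abbrev Pattern (Λ : Type*) := Σ n : ℕ, (Finset.Icc (-(n : ℤ)) n → Λ × Prop)

/-- The pattern `w` occurs in `(y, I)` at the position `i`. -/
def OccursAt {Λ : Type*} (y : ℤ → Λ) (I : Set ℤ) (w : Pattern Λ) (i : ℤ) : Prop :=
  ∀ k : Finset.Icc (-(w.1 : ℤ)) w.1,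
    y (i + k) = (w.2 k).1 ∧ (i + (k : ℤ) ∈ I ↔ (w.2 k).2)

/-- The pattern `w` occurs in `(y, I)`, and distinct occurrences are separated by at least `δ⁻¹`
elements of `I`. -/
def IsMarker {Λ : Type*} (y : ℤ → Λ) (I : Set ℤ) (δ : ℝ) (w : Pattern Λ) : Prop :=
  (∃ i, OccursAt y I w i) ∧
    ∀ i j, OccursAt y I w i → OccursAt y I w j → i < j → 1 ≤ δ * count I i j

/-- The occurrences of the marker pattern with the least code. -/
def markers {Λ : Type*} (e : Pattern Λ → ℕ) (y : ℤ → Λ) (I : Set ℤ) (δ : ℝ) : Set ℤ :=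
  {i | ∃ w, IsMarker y I δ w ∧ (∀ v, IsMarker y I δ v → e w ≤ e v) ∧ OccursAt y I w i}

/-- `m` is the last element of `M` in `(-∞, i]`. -/
def IsLast (M : Set ℤ) (i m : ℤ) : Prop :=
  m ∈ M ∧ m ≤ i ∧ ∀ k, m < k → k ≤ i → k ∉ M

/-- The elements of `I` selected by the Beatty sequence of slope `t`, restarted at every element
of `M`. -/
def select (M I : Set ℤ) (t : ℝ) : Set ℤ :=
  {i | i ∈ I ∧ ∃ m, IsLast M i m ∧ ⌊t * (count I m i + 1)⌋ ≠ ⌊t * count I m i⌋}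

lemma count_shiftSet (I : Set ℤ) (a b : ℤ) :
    count (shiftSet I) a b = count I (a + 1) (b + 1) := by
  unfold count
  rw [← Finset.image_add_right_Ico, Finset.sum_image (fun _ _ _ _ h => by simpa using h)]
  rfl

lemma count_succ (I : Set ℤ) {a b : ℤ} (h : a ≤ b) :
    count I a (b + 1) = count I a b + if b ∈ I then (1 : ℝ) else 0 := by
  unfold count
  rw [← Finset.insert_Ico_right_eq_Ico_add_one h, Finset.sum_insert (by simp), add_comm]

lemma count_nonneg (I : Set ℤ) (a b : ℤ) : 0 ≤ count I a b :=
  Finset.sum_nonneg fun _ _ => by split_ifs <;> simp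

lemma count_mono (I : Set ℤ) (a : ℤ) {b c : ℤ} (h : b ≤ c) : count I a b ≤ count I a c :=
  Finset.sum_le_sum_of_subset_of_nonneg (Finset.Ico_subset_Ico_right h)
    fun _ _ _ => by split_ifs <;> simp

lemma count_zero_natCast (I : Set ℤ) (N : ℕ) :
    count I 0 N = ∑ i ∈ Finset.range N, if (i : ℤ) ∈ I then (1 : ℝ) else 0 := by
  induction N with
  | zero => simp [count]
  | succ N ih => rw [Finset.sum_range_succ, ← ih, Nat.cast_succ, count_succ I (by positivity)]

lemma count_sdiff {I J : Set ℤ} (h : J ⊆ I) (a b : ℤ) :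
    count (I \ J) a b = count I a b - count J a b := by
  unfold count
  rw [← Finset.sum_sub_distrib]
  refine Finset.sum_congr rfl fun k _ => ?_
  by_cases hJ : k ∈ J
  · simp [hJ, h hJ]
  · simp [hJ]

lemma count_zero_le (I : Set ℤ) (N : ℕ) : count I 0 N ≤ N := by
  unfold count
  calc _ ≤ ∑ k ∈ Finset.Ico (0 : ℤ) N, (1 : ℝ) :=
        Finset.sum_le_sum fun _ _ => by split_ifs <;> simp
    _ = N := by simp

lemma occursAt_shift {Λ : Type*} (y : ℤ → Λ) (I : Set ℤ) (w : Pattern Λ) (i : ℤ) :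
    OccursAt (shift y) (shiftSet I) w i ↔ OccursAt y I w (i + 1) := by
  simp only [OccursAt, shift, shiftSet, Set.mem_ofPred_eq, add_right_comm]

lemma isMarker_shift {Λ : Type*} (y : ℤ → Λ) (I : Set ℤ) (δ : ℝ) (w : Pattern Λ) :
    IsMarker (shift y) (shiftSet I) δ w ↔ IsMarker y I δ w := by
  simp only [IsMarker, occursAt_shift, count_shiftSet]
  refine and_congr ((Equiv.addRight (1 : ℤ)).surjective.exists (p := OccursAt y I w)).symm ?_
  constructor
  · intro h i j hi hj hij
    simpa using h (i - 1) (j - 1) (by simpa using hi) (by simpa using hj) (by simpa using hij)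
  · intro h i j hi hj hij
    exact h _ _ hi hj (by simpa using hij)

lemma markers_shift {Λ : Type*} (e : Pattern Λ → ℕ) (y : ℤ → Λ) (I : Set ℤ) (δ : ℝ) :
    markers e (shift y) (shiftSet I) δ = shiftSet (markers e y I δ) := by
  ext i
  simp only [markers, isMarker_shift, occursAt_shift]
  rfl

lemma isLast_shiftSet (M : Set ℤ) (i m : ℤ) :
    IsLast (shiftSet M) i m ↔ IsLast M (i + 1) (m + 1) := by
  simp only [IsLast, shiftSet, Set.mem_ofPred_eq, add_le_add_iff_right]
  refine and_congr Iff.rfl (and_congr Iff.rfl ⟨fun h k h1 h2 => ?_, fun h k h1 h2 => ?_⟩)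
  · simpa using h (k - 1) (by lia) (by lia)
  · exact h (k + 1) (by lia) (by lia)

lemma select_shiftSet (M I : Set ℤ) (t : ℝ) :
    select (shiftSet M) (shiftSet I) t = shiftSet (select M I t) := by
  ext i
  simp only [select, isLast_shiftSet, count_shiftSet]
  simp only [shiftSet, Set.mem_ofPred_eq]
  exact and_congr Iff.rfl ((Equiv.addRight (1 : ℤ)).surjective.exists (p := fun m =>
    IsLast M (i + 1) m ∧ ⌊t * (count I m (i + 1) + 1)⌋ ≠ ⌊t * count I m (i + 1)⌋)).symm

lemma IsLast.unique {M : Set ℤ} {i m m' : ℤ} (h : IsLast M i m) (h' : IsLast M i m') :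
    m = m' := by
  rcases lt_trichotomy m m' with hlt | heq | hlt
  · exact absurd h'.1 (h.2.2 _ hlt h'.2.1)
  · exact heq
  · exact absurd h.1 (h'.2.2 _ hlt h.2.1)

lemma exists_isLast {M : Set ℤ} {a i : ℤ} (ha : a ∈ M) (hai : a ≤ i) : ∃ m, IsLast M i m := by
  obtain ⟨m, ⟨hm, hmi⟩, hmax⟩ := Int.exists_greatest_of_bdd (P := fun z => z ∈ M ∧ z ≤ i)
    ⟨i, fun z hz => hz.2⟩ ⟨a, ha, hai⟩
  exact ⟨m, hm, hmi, fun k hk hki hkM => absurd (hmax k ⟨hkM, hki⟩) (by lia)⟩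

/-- Membership in the selected set, measured by the increment of the Beatty sequence. -/
lemma select_indicator {M I : Set ℤ} {t : ℝ} (h0 : 0 ≤ t) (h1 : t ≤ 1) {i m : ℤ}
    (hm : IsLast M i m) :
    (if i ∈ select M I t then (1 : ℝ) else 0) =
      ⌊t * count I m (i + 1)⌋ - ⌊t * count I m i⌋ := by
  rw [count_succ I hm.2.1]
  by_cases hi : i ∈ I
  · have hsel : i ∈ select M I t ↔ ⌊t * (count I m i + 1)⌋ ≠ ⌊t * count I m i⌋ := by
      refine ⟨fun h => ?_, fun h => ⟨hi, m, hm, h⟩⟩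
      obtain ⟨-, m', hm', h⟩ := h
      rwa [hm.unique hm']
    have hle : ⌊t * count I m i⌋ ≤ ⌊t * (count I m i + 1)⌋ := Int.floor_le_floor (by nlinarith)
    have hge : ⌊t * (count I m i + 1)⌋ ≤ ⌊t * count I m i⌋ + 1 := by
      rw [← Int.floor_add_one]
      exact Int.floor_le_floor (by nlinarith)
    simp only [hi, if_true]
    by_cases hne : ⌊t * (count I m i + 1)⌋ = ⌊t * count I m i⌋
    · rw [if_neg (by rw [hsel]; exact not_not.2 hne), hne, sub_self]
    · rw [if_pos (hsel.2 hne), show ⌊t * (count I m i + 1)⌋ = ⌊t * count I m i⌋ + 1 by lia]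
      push_cast; ring
  · rw [if_neg fun h => hi h.1, if_neg hi, add_zero, sub_self]

/-- Up to a constant, the selected set contains a proportion between `t - δ` and `t` of every
initial segment of `I`. -/
lemma count_select_bounds {M I : Set ℤ} {t δ : ℝ} (h0 : 0 ≤ t) (h1 : t ≤ 1) (hδ : 0 ≤ δ)
    (hne : M.Nonempty)
    (hgap : ∀ i ∈ M, ∀ j ∈ M, i < j → 1 ≤ δ * count I i j) :
    ∃ C : ℝ, ∃ N₀ : ℕ, ∀ N : ℕ, N₀ ≤ N →
      count (select M I t) 0 N ≤ t * count I 0 N + C ∧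
      (t - δ) * count I 0 N - C ≤ count (select M I t) 0 N := by
  obtain ⟨a, ha⟩ := hne
  set A : ℕ → ℝ := fun N => count (select M I t) 0 N
  set B : ℕ → ℝ := fun N => count I 0 N
  obtain ⟨m₀, hm₀⟩ := exists_isLast (i := (a.toNat : ℤ)) ha (by lia)
  set E : ℕ → ℤ → ℝ := fun N m => A N - t * B N + Int.fract (t * count I m N)
  obtain ⟨C, hC⟩ : ∃ C, C = |E a.toNat m₀| + δ * count I m₀ a.toNat := ⟨_, rfl⟩
  have key : ∀ N : ℕ, a.toNat ≤ N → ∃ m, IsLast M N m ∧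
      E N m ≤ C ∧ -(δ * (B N - count I m N)) - C ≤ E N m := by
    intro N hN
    induction N, hN using Nat.le_induction with
    | base =>
      have hB : 0 ≤ δ * B a.toNat := mul_nonneg hδ (count_nonneg _ _ _)
      have hc : 0 ≤ δ * count I m₀ a.toNat := mul_nonneg hδ (count_nonneg _ _ _)
      have := neg_abs_le (E a.toNat m₀)
      have := le_abs_self (E a.toNat m₀)
      exact ⟨m₀, hm₀, by linarith, by linarith⟩
    | succ N hN ih =>
      obtain ⟨m, hm, hu, hl⟩ := ih
      have hA : A (N + 1) = A N + (⌊t * count I m (N + 1)⌋ - ⌊t * count I m N⌋) := by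
        rw [← select_indicator h0 h1 hm]
        simp only [A, Nat.cast_succ]
        exact count_succ _ (by positivity)
      have hB : B (N + 1) = B N + if (N : ℤ) ∈ I then (1 : ℝ) else 0 := by
        simp only [B, Nat.cast_succ]
        exact count_succ _ (by positivity)
      have hc := count_succ I hm.2.1
      have hE : A (N + 1) - t * B (N + 1) + Int.fract (t * count I m (N + 1)) = E N m := by
        simp only [E, hA, hB, Int.fract, hc]
        ring
      by_cases hM : (N : ℤ) + 1 ∈ M
      · refine ⟨N + 1, ⟨hM, by push_cast; rfl, fun k hk hk' => by push_cast at hk'; lia⟩, ?_⟩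
        have hg := hgap m hm.1 _ hM (by have := hm.2.1; lia)
        have hz : count I (N + 1) (N + 1) = 0 := by simp [count]
        have hE' : E (N + 1) (N + 1) = A (N + 1) - t * B (N + 1) := by
          simp [E, hz]
        have hf := Int.fract_nonneg (t * count I m (N + 1))
        have hf' := Int.fract_lt_one (t * count I m (N + 1))
        rw [hE', Nat.cast_succ, hz]
        refine ⟨by linarith, ?_⟩
        have : δ * (B (N + 1) - 0) = δ * (B N - count I m N) + δ * count I m (N + 1) := by
          rw [hB, hc]; ring
        linarith
      · refine ⟨m, ⟨hm.1, by have := hm.2.1; push_cast; lia, fun k hk hk' => ?_⟩, ?_⟩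
        · push_cast at hk'
          rcases hk'.lt_or_eq with h | rfl
          · exact hm.2.2 k hk (by lia)
          · exact hM
        · have hE' : E (N + 1) m = E N m := by
            rw [← hE]; simp only [E, Nat.cast_succ]
          have : B (N + 1) - count I m ((N + 1 : ℕ) : ℤ) = B N - count I m N := by
            rw [hB, Nat.cast_succ, hc]; ring
          rw [hE', this]
          exact ⟨hu, hl⟩
  refine ⟨C + 1, a.toNat, fun N hN => ?_⟩
  obtain ⟨m, -, hu, hl⟩ := key N hN
  have hf := Int.fract_nonneg (t * count I m N)
  have hf' := Int.fract_lt_one (t * count I m N)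
  have hc : 0 ≤ δ * count I m N := mul_nonneg hδ (count_nonneg _ _ _)
  simp only [E, A, B] at hu hl
  constructor <;> linarith

/-- For aperiodic `y`, a marker pattern exists as soon as `I` has at least `δ⁻¹` elements in some
initial segment. -/
lemma exists_isMarker {Λ : Type*} {y : ℤ → Λ} (hy : Aperiodic y) {I : Set ℤ} {δ : ℝ}
    (hδ : 0 ≤ δ) {N : ℕ} (hN : 1 ≤ δ * count I 0 N) : ∃ w, IsMarker y I δ w := by
  have hap : ∀ p : ℕ, ∃ j : ℤ, 1 ≤ p → y (j + p) ≠ y j := by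
    intro p
    by_contra! h
    exact hy p (h 0).1 (funext fun i => (h i).2)
  choose j hj using hap
  set n : ℕ := N + ∑ p ∈ Finset.range (N + 1), ((j p).natAbs + p) with hn
  have hjn : ∀ p ≤ N, (j p).natAbs + p ≤ n := fun p hp =>
    (Finset.single_le_sum (f := fun p => (j p).natAbs + p) (fun _ _ => Nat.zero_le _)
      (Finset.mem_range.2 (Nat.lt_succ_of_le hp))).trans (Nat.le_add_left _ _)
  let w : Pattern Λ := ⟨n, fun k => (y k, (k : ℤ) ∈ I)⟩
  have hw : ∀ i, OccursAt y I w i → ∀ k : ℤ, -(n : ℤ) ≤ k → k ≤ n →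
      y (i + k) = y k ∧ (i + k ∈ I ↔ k ∈ I) := fun i hi k h1 h2 =>
    hi ⟨k, Finset.mem_Icc.2 ⟨h1, h2⟩⟩
  refine ⟨w, ⟨0, fun k => by simp [w]⟩, fun i i' hi hi' hlt => ?_⟩
  have hfar : i + N ≤ i' := by
    by_contra! hlt'
    obtain ⟨p, hp⟩ := Int.eq_ofNat_of_zero_le (sub_nonneg.2 hlt.le)
    obtain rfl : i' = i + p := by lia
    have hpN := hjn p (by lia)
    apply hj p (by lia)
    rw [← (hw i hi (j p + p) (by lia) (by lia)).1, ← (hw _ hi' (j p) (by lia) (by lia)).1]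
    congr 1
    ring
  have htrans : ∀ M : ℕ, M ≤ N → count I i (i + M) = count I 0 M := by
    intro M hM
    induction M with
    | zero => simp [count]
    | succ M ih =>
      rw [Nat.cast_succ, ← add_assoc, count_succ I (by lia), count_succ I (by lia),
        ih (by lia)]
      simp only [(hw i hi M (by lia) (by lia)).2]
  calc 1 ≤ δ * count I 0 N := hN
    _ = δ * count I i (i + N) := by rw [htrans N le_rfl]
    _ ≤ δ * count I i i' := mul_le_mul_of_nonneg_left (count_mono I i hfar) hδ

lemma markers_nonempty {Λ : Type*} (e : Pattern Λ → ℕ) {y : ℤ → Λ} {I : Set ℤ} {δ : ℝ}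
    (h : ∃ w, IsMarker y I δ w) : (markers e y I δ).Nonempty := by
  obtain ⟨w, hw, hmin⟩ := (InvImage.wf e Nat.lt_wfRel.wf).has_min {w | IsMarker y I δ w} h
  obtain ⟨i, hi⟩ := hw.1
  exact ⟨i, w, hw, fun v hv => not_lt.1 (hmin v hv), hi⟩

lemma markers_gap {Λ : Type*} {e : Pattern Λ → ℕ} (he : Function.Injective e) {y : ℤ → Λ}
    {I : Set ℤ} {δ : ℝ} {i j : ℤ} (hi : i ∈ markers e y I δ) (hj : j ∈ markers e y I δ)
    (hij : i < j) : 1 ≤ δ * count I i j := by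
  obtain ⟨w, hw, hmin, hwi⟩ := hi
  obtain ⟨v, hv, hmin', hvj⟩ := hj
  obtain rfl : w = v := he (le_antisymm (hmin v hv) (hmin' w hw))
  exact hw.2 i j hwi hvj hij

section Density

variable {I J : Set ℤ}

lemma lowerDensity_eq (I : Set ℤ) :
    lowerDensity I = liminf (fun N : ℕ => count I 0 N / N) atTop := by
  simp only [lowerDensity, count_zero_natCast]

lemma upperDensity_eq (I : Set ℤ) :
    upperDensity I = limsup (fun N : ℕ => count I 0 N / N) atTop := by
  simp only [upperDensity, count_zero_natCast]

lemma isBoundedUnder_le_density (I : Set ℤ) :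
    IsBoundedUnder (· ≤ ·) atTop (fun N : ℕ => count I 0 N / N) :=
  isBoundedUnder_of ⟨1, fun N => div_le_one_of_le₀ (count_zero_le I N) N.cast_nonneg⟩

lemma isBoundedUnder_ge_density (I : Set ℤ) :
    IsBoundedUnder (· ≥ ·) atTop (fun N : ℕ => count I 0 N / N) :=
  isBoundedUnder_of ⟨0, fun N => div_nonneg (count_nonneg I 0 N) N.cast_nonneg⟩

lemma eventually_density_ge {c C : ℝ} (hc : 0 ≤ c) {N₀ : ℕ}
    (h : ∀ N : ℕ, N₀ ≤ N → c * count I 0 N - C ≤ count J 0 N) {ε : ℝ} (hε : 0 < ε) (d : ℝ) :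
    ∀ᶠ N : ℕ in atTop, d - ε / (2 * (c + 1)) < count I 0 N / N →
      c * d - ε ≤ count J 0 N / N := by
  have hlim : ∀ᶠ N : ℕ in atTop, C / N < ε / 2 :=
    (tendsto_const_div_atTop_nhds_zero_nat C).eventually_lt_const (half_pos hε)
  filter_upwards [hlim, eventually_ge_atTop N₀, eventually_gt_atTop 0] with N h1 h2 h3 h4
  have hN : (0 : ℝ) < N := Nat.cast_pos.2 h3
  have h5 : c * (count I 0 N / N) - C / N ≤ count J 0 N / N := by
    rw [← mul_div_assoc, ← sub_div]
    exact div_le_div_of_nonneg_right (h N h2) hN.le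
  have h6 : c * (ε / (2 * (c + 1))) ≤ ε / 2 := by
    rw [← mul_div_assoc, div_le_div_iff₀ (by positivity) two_pos]
    nlinarith
  have h7 := mul_le_mul_of_nonneg_left h4.le hc
  linarith

lemma mul_lowerDensity_le {c C : ℝ} (hc : 0 ≤ c) {N₀ : ℕ}
    (h : ∀ N : ℕ, N₀ ≤ N → c * count I 0 N - C ≤ count J 0 N) :
    c * lowerDensity I ≤ lowerDensity J := by
  refine le_of_forall_pos_sub_le fun ε hε => ?_
  rw [lowerDensity_eq J]
  refine le_liminf_of_le (isBoundedUnder_le_density J).isCoboundedUnder_ge ?_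
  have hlt : lowerDensity I - ε / (2 * (c + 1)) < lowerDensity I :=
    sub_lt_self _ (by positivity)
  nth_rewrite 2 [lowerDensity_eq] at hlt
  exact (eventually_density_ge hc h hε _).mp
    ((eventually_lt_of_lt_liminf hlt (isBoundedUnder_ge_density I)).mono fun N h1 h2 => h2 h1)

lemma mul_upperDensity_le {c C : ℝ} (hc : 0 ≤ c) {N₀ : ℕ}
    (h : ∀ N : ℕ, N₀ ≤ N → c * count I 0 N - C ≤ count J 0 N) :
    c * upperDensity I ≤ upperDensity J := by
  refine le_of_forall_pos_sub_le fun ε hε => ?_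
  rw [upperDensity_eq J]
  have hlt : upperDensity I - ε / (2 * (c + 1)) < upperDensity I :=
    sub_lt_self _ (by positivity)
  nth_rewrite 2 [upperDensity_eq] at hlt
  refine le_limsup_of_frequently_le ?_ (isBoundedUnder_le_density J)
  exact (frequently_lt_of_lt_limsup (isBoundedUnder_ge_density I).isCoboundedUnder_le hlt).mp
    ((eventually_density_ge hc h hε _).mono fun N h1 h2 => h1 h2)

end Density

section Measurability

variable {Λ α : Type*} [MeasurableSpace Λ] [DiscreteMeasurableSpace Λ]
  [MeasurableSpace α] {y : α → ℤ → Λ} {I M : α → Set ℤ} {δ t : α → ℝ}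

lemma measurable_count (hI : Measurable I) (a b : ℤ) :
    Measurable fun x => count (I x) a b :=
  Finset.measurable_fun_sum _ fun k _ =>
    Measurable.ite (measurableSet_setOfPred.2 (measurable_set_iff.1 hI k)) measurable_const
      measurable_const

lemma measurable_occursAt (hy : Measurable y) (hI : Measurable I) (w : Pattern Λ) (i : ℤ) :
    Measurable fun x => OccursAt (y x) (I x) w i := by
  refine Measurable.forall fun k => Measurable.and ?_ ?_
  · exact (Measurable.of_discrete (f := fun l : Λ => l = (w.2 k).1)).comp
      ((measurable_pi_apply (i + (k : ℤ))).comp hy)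
  · exact (measurable_set_iff.1 hI _).iff measurable_const

lemma measurable_isMarker (hy : Measurable y) (hI : Measurable I) (hδ : Measurable δ)
    (w : Pattern Λ) : Measurable fun x => IsMarker (y x) (I x) (δ x) w := by
  refine Measurable.and (Measurable.exists fun i => measurable_occursAt hy hI w i)
    (Measurable.forall fun i => Measurable.forall fun j =>
      (measurable_occursAt hy hI w i).imp ((measurable_occursAt hy hI w j).imp
        (measurable_const.imp ?_)))
  exact measurableSet_setOfPred.1
    (measurableSet_le measurable_const (hδ.mul (measurable_count hI i j)))

lemma measurable_markers [Countable Λ] (e : Pattern Λ → ℕ) (hy : Measurable y) (hI : Measurable I)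
    (hδ : Measurable δ) : Measurable fun x => markers e (y x) (I x) (δ x) :=
  measurable_set_iff.2 fun i => Measurable.exists fun w =>
    (measurable_isMarker hy hI hδ w).and
      ((Measurable.forall fun v => (measurable_isMarker hy hI hδ v).imp measurable_const).and
        (measurable_occursAt hy hI w i))

lemma measurable_isLast (hM : Measurable M) (i m : ℤ) :
    Measurable fun x => IsLast (M x) i m :=
  (measurable_set_iff.1 hM m).and (measurable_const.and (Measurable.forall fun k =>
    measurable_const.imp (measurable_const.imp (measurable_set_iff.1 hM k).not)))

lemma measurable_select (hM : Measurable M) (hI : Measurable I) (ht : Measurable t) :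
    Measurable fun x => select (M x) (I x) (t x) := by
  refine measurable_set_iff.2 fun i => (measurable_set_iff.1 hI i).and
    (Measurable.exists fun m => (measurable_isLast hM i m).and (Measurable.not ?_))
  have hc := measurable_count hI m i
  exact measurableSet_setOfPred.1 (measurableSet_eq_fun
    (ht.mul (hc.add measurable_const)).floor (ht.mul hc).floor)

end Measurability

/-- **Stationary selection.** There is a Borel map assigning to each aperiodic `y ∈ Λ^ℤ`,
each `I ⊆ ℤ` and each pair `0 ≤ t₁ < t₂ ≤ 1` a subset `J ⊆ I`, equivariantly
(`(Sy, SI, t₁, t₂) ↦ SJ`), with `s̲(J) ≥ t₁·s̲(I)`, `s̲(I∖J) ≥ (1−t₂)·s̲(I)`, and likewise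
for upper densities. -/
theorem stationary_selection {Λ : Type*} [Countable Λ]
    [MeasurableSpace Λ] [DiscreteMeasurableSpace Λ] :
    ∃ Jmap : (ℤ → Λ) → Set ℤ → ℝ → ℝ → Set ℤ,
      Measurable (fun p : (ℤ → Λ) × Set ℤ × ℝ × ℝ => Jmap p.1 p.2.1 p.2.2.1 p.2.2.2) ∧
      ∀ (y : ℤ → Λ) (I : Set ℤ) (t₁ t₂ : ℝ),
        Aperiodic y → 0 ≤ t₁ → t₁ < t₂ → t₂ ≤ 1 →
          Jmap y I t₁ t₂ ⊆ I ∧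
          Jmap (shift y) (shiftSet I) t₁ t₂ = shiftSet (Jmap y I t₁ t₂) ∧
          t₁ * lowerDensity I ≤ lowerDensity (Jmap y I t₁ t₂) ∧
          (1 - t₂) * lowerDensity I ≤ lowerDensity (I \ Jmap y I t₁ t₂) ∧
          t₁ * upperDensity I ≤ upperDensity (Jmap y I t₁ t₂) ∧
          (1 - t₂) * upperDensity I ≤ upperDensity (I \ Jmap y I t₁ t₂) := by
  obtain ⟨e, he⟩ := exists_injective_nat (Pattern Λ)
  refine ⟨fun y I t₁ t₂ => select (markers e y I (t₂ - t₁)) I t₂, ?_, ?_⟩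
  · exact measurable_select (measurable_markers e (by fun_prop) (by fun_prop) (by fun_prop))
      (by fun_prop) (by fun_prop)
  intro y I t₁ t₂ hy h0 h12 h1
  have hδ : 0 < t₂ - t₁ := sub_pos.2 h12
  set J := select (markers e y I (t₂ - t₁)) I t₂
  have hJI : J ⊆ I := fun i hi => hi.1
  obtain ⟨C, N₀, hC⟩ : ∃ C : ℝ, ∃ N₀ : ℕ, ∀ N : ℕ, N₀ ≤ N →
      t₁ * count I 0 N - C ≤ count J 0 N ∧
      (1 - t₂) * count I 0 N - C ≤ count (I \ J) 0 N := by
    by_cases hbig : ∃ N : ℕ, 1 ≤ (t₂ - t₁) * count I 0 N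
    · obtain ⟨N, hN⟩ := hbig
      obtain ⟨C, N₀, hC⟩ := count_select_bounds (t := t₂) (h0.trans h12.le) h1 hδ.le
        (markers_nonempty e (exists_isMarker hy hδ.le hN))
        (fun i hi j hj hij => markers_gap he hi hj hij)
      refine ⟨C, N₀, fun N hN => ?_⟩
      obtain ⟨hu, hl⟩ := hC N hN
      rw [sub_sub_cancel] at hl
      refine ⟨hl, ?_⟩
      rw [count_sdiff hJI]
      linarith
    · push Not at hbig
      have hB : ∀ N : ℕ, count I 0 N ≤ 1 / (t₂ - t₁) := fun N => by
        rw [le_div_iff₀ hδ, mul_comm]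
        exact (hbig N).le
      refine ⟨1 / (t₂ - t₁), 0, fun N _ => ?_⟩
      have hI0 := count_nonneg I 0 N
      have hJ := count_nonneg J 0 N
      have hIJ := count_nonneg (I \ J) 0 N
      have := hB N
      constructor <;> nlinarith
  refine ⟨hJI, ?_, mul_lowerDensity_le h0 fun N hN => (hC N hN).1,
    mul_lowerDensity_le (sub_nonneg.2 h1) fun N hN => (hC N hN).2,
    mul_upperDensity_le h0 fun N hN => (hC N hN).1,
    mul_upperDensity_le (sub_nonneg.2 h1) fun N hN => (hC N hN).2⟩
  simp only [markers_shift, select_shiftSet]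
end
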